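/- Let F be any field and let S ⊆ F be any finite subset. Then the set of real numbers {Q~(T) : n1, n2, n3 ∈ ℕ, T ∈ F^{n1} ⊗ F^{n2} ⊗ F^{n3} an order-three tensor all of whose coefficients in the standard bases lie in S} has no accumulation points. -/

import Mathlib

open scoped BigOperators

namespace Paper

variable {F : Type*} [Field F]

/-- Restriction of order-three tensors: `T ≥ S` iff there exist linear maps
(given by matrices `L1, L2, L3`) carrying `T` to `S`. -/
def Restricts {ι1 ι2 ι3 κ1 κ2 κ3 : Type*} [Fintype ι1] [Fintype ι2] [Fintype ι3]
    (T : ι1 → ι2 → ι3 → F) (S : κ1 → κ2 → κ3 → F) : Prop :=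
  ∃ (L1 : κ1 → ι1 → F) (L2 : κ2 → ι2 → F) (L3 : κ3 → ι3 → F),
    ∀ a b c, S a b c = ∑ i, ∑ j, ∑ k, L1 a i * L2 b j * L3 c k * T i j k

/-- The unit (diagonal) tensor `⟨r⟩`. -/
def unitTensor (F : Type*) [Field F] (r : ℕ) : Fin r → Fin r → Fin r → F :=
  fun i j k => if i = j ∧ j = k then 1 else 0

/-- The subrank `Q(T)`: the largest `r` such that `T` restricts to `⟨r⟩`. -/
noncomputable def subrank {ι1 ι2 ι3 : Type*} [Fintype ι1] [Fintype ι2] [Fintype ι3]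
    (T : ι1 → ι2 → ι3 → F) : ℕ :=
  sSup {r : ℕ | Restricts T (unitTensor F r)}

/-- Kronecker (tensor) power `T^{⊠ m}` of an order-three tensor. -/
def kronPow {ι1 ι2 ι3 : Type*} (T : ι1 → ι2 → ι3 → F) (m : ℕ) :
    (Fin m → ι1) → (Fin m → ι2) → (Fin m → ι3) → F :=
  fun x y z => ∏ s : Fin m, T (x s) (y s) (z s)

/-- Asymptotic subrank `Q~(T) = lim_n Q(T^{⊠n})^{1/n} = sup_n Q(T^{⊠n})^{1/n}`. -/
noncomputable def asympSubrank {ι1 ι2 ι3 : Type*} [Fintype ι1] [Fintype ι2] [Fintype ι3]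
    (T : ι1 → ι2 → ι3 → F) : ℝ :=
  ⨆ m : ℕ, (subrank (kronPow T (m + 1)) : ℝ) ^ ((1 : ℝ) / (m + 1))

/-- First flattening of a tensor. -/
def flattening1 {ι1 ι2 ι3 : Type*} (T : ι1 → ι2 → ι3 → F) : Matrix ι1 (ι2 × ι3) F :=
  Matrix.of fun i p => T i p.1 p.2

/-- Second flattening of a tensor. -/
def flattening2 {ι1 ι2 ι3 : Type*} (T : ι1 → ι2 → ι3 → F) : Matrix ι2 (ι1 × ι3) F :=
  Matrix.of fun j p => T p.1 j p.2

/-- Third flattening of a tensor. -/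
def flattening3 {ι1 ι2 ι3 : Type*} (T : ι1 → ι2 → ι3 → F) : Matrix ι3 (ι1 × ι2) F :=
  Matrix.of fun k p => T p.1 p.2 k

/-- A tensor is concise if all three flattening ranks are maximal. -/
noncomputable def Concise {ι1 ι2 ι3 : Type*} [Fintype ι1] [Fintype ι2] [Fintype ι3]
    (T : ι1 → ι2 → ι3 → F) : Prop :=
  (flattening1 T).rank = Fintype.card ι1 ∧
  (flattening2 T).rank = Fintype.card ι2 ∧
  (flattening3 T).rank = Fintype.card ι3

/-- A tensor has slice rank one if one of its flattenings has rank one. -/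
noncomputable def SliceRankOne {ι1 ι2 ι3 : Type*} [Fintype ι1] [Fintype ι2] [Fintype ι3]
    (T : ι1 → ι2 → ι3 → F) : Prop :=
  (flattening1 T).rank = 1 ∨ (flattening2 T).rank = 1 ∨ (flattening3 T).rank = 1

/-- The slice rank `SR(T)`: the least `r` such that `T` is a sum of `r` slice-rank-one
tensors. -/
noncomputable def sliceRank {ι1 ι2 ι3 : Type*} [Fintype ι1] [Fintype ι2] [Fintype ι3]
    (T : ι1 → ι2 → ι3 → F) : ℕ :=
  sInf {r : ℕ | ∃ f : Fin r → (ι1 → ι2 → ι3 → F),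
    (∀ t, SliceRankOne (f t)) ∧ T = ∑ t, f t}

/-- The liminf-asymptotic slice rank. -/
noncomputable def asympSliceRankInf {ι1 ι2 ι3 : Type*} [Fintype ι1] [Fintype ι2] [Fintype ι3]
    (T : ι1 → ι2 → ι3 → F) : ℝ :=
  Filter.liminf (fun m : ℕ => (sliceRank (kronPow T m) : ℝ) ^ ((1 : ℝ) / m)) Filter.atTop

/-- The limsup-asymptotic slice rank. -/
noncomputable def asympSliceRankSup {ι1 ι2 ι3 : Type*} [Fintype ι1] [Fintype ι2] [Fintype ι3]
    (T : ι1 → ι2 → ι3 → F) : ℝ :=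
  Filter.limsup (fun m : ℕ => (sliceRank (kronPow T m) : ℝ) ^ ((1 : ℝ) / m)) Filter.atTop

/-- The max-rank of a matrix subspace. -/
noncomputable def maxrank {m n : Type*} [Fintype n] (𝒜 : Submodule F (Matrix m n F)) : ℕ :=
  sSup {r : ℕ | ∃ A ∈ 𝒜, A.rank = r}

/-- The min-rank of a matrix subspace: the least rank of a nonzero element. -/
noncomputable def minrank {m n : Type*} [Fintype n] (𝒜 : Submodule F (Matrix m n F)) : ℕ :=
  sInf {r : ℕ | ∃ A ∈ 𝒜, A ≠ 0 ∧ A.rank = r}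

section Slices

variable {n1 n2 n3 : ℕ}

/-- Span of the 3-slices, rows indexed by direction 1, columns by direction 2. -/
def span12 (T : Fin n1 → Fin n2 → Fin n3 → F) : Submodule F (Matrix (Fin n1) (Fin n2) F) :=
  Submodule.span F (Set.range fun k : Fin n3 => Matrix.of fun i j => T i j k)

/-- Span of the 3-slices, rows indexed by direction 2, columns by direction 1. -/
def span21 (T : Fin n1 → Fin n2 → Fin n3 → F) : Submodule F (Matrix (Fin n2) (Fin n1) F) :=
  Submodule.span F (Set.range fun k : Fin n3 => Matrix.of fun j i => T i j k)

/-- Span of the 2-slices, rows indexed by direction 1, columns by direction 3. -/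
def span13 (T : Fin n1 → Fin n2 → Fin n3 → F) : Submodule F (Matrix (Fin n1) (Fin n3) F) :=
  Submodule.span F (Set.range fun j : Fin n2 => Matrix.of fun i k => T i j k)

/-- Span of the 2-slices, rows indexed by direction 3, columns by direction 1. -/
def span31 (T : Fin n1 → Fin n2 → Fin n3 → F) : Submodule F (Matrix (Fin n3) (Fin n1) F) :=
  Submodule.span F (Set.range fun j : Fin n2 => Matrix.of fun k i => T i j k)

/-- Span of the 1-slices, rows indexed by direction 2, columns by direction 3. -/
def span23 (T : Fin n1 → Fin n2 → Fin n3 → F) : Submodule F (Matrix (Fin n2) (Fin n3) F) :=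
  Submodule.span F (Set.range fun i : Fin n1 => Matrix.of fun j k => T i j k)

/-- Span of the 1-slices, rows indexed by direction 3, columns by direction 2. -/
def span32 (T : Fin n1 → Fin n2 → Fin n3 → F) : Submodule F (Matrix (Fin n3) (Fin n2) F) :=
  Submodule.span F (Set.range fun i : Fin n1 => Matrix.of fun k j => T i j k)

/-- `Q_1(T)`: max-rank of the span of the 1-slices. -/
noncomputable def Q1 (T : Fin n1 → Fin n2 → Fin n3 → F) : ℕ := maxrank (span23 T)

/-- `Q_2(T)`: max-rank of the span of the 2-slices. -/
noncomputable def Q2 (T : Fin n1 → Fin n2 → Fin n3 → F) : ℕ := maxrank (span13 T)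

/-- `Q_3(T)`: max-rank of the span of the 3-slices. -/
noncomputable def Q3 (T : Fin n1 → Fin n2 → Fin n3 → F) : ℕ := maxrank (span12 T)

end Slices

/-- `p` is the pivot of the matrix `A`: the lexicographically least position of a
nonzero entry. -/
def IsPivot {n1 n2 : ℕ} (A : Matrix (Fin n1) (Fin n2) F) (p : Fin n1 × Fin n2) : Prop :=
  A p.1 p.2 ≠ 0 ∧ ∀ q : Fin n1 × Fin n2, A q.1 q.2 ≠ 0 → p.1 < q.1 ∨ (p.1 = q.1 ∧ p.2 ≤ q.2)

/-- The set of pivots of a matrix subspace (equal to the pivots of any basis with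
pairwise distinct pivots). -/
def pivotSet {n1 n2 : ℕ} (𝒜 : Submodule F (Matrix (Fin n1) (Fin n2) F)) :
    Set (Fin n1 × Fin n2) :=
  {p | ∃ A ∈ 𝒜, IsPivot A p}

/-- `ρ(𝒜)`: the least `r = |S1| + |S2|` such that the pivots of `𝒜` are covered by the
rows `S1` and columns `S2`. -/
noncomputable def rho {n1 n2 : ℕ} (𝒜 : Submodule F (Matrix (Fin n1) (Fin n2) F)) : ℕ :=
  sInf {r : ℕ | ∃ (S1 : Finset (Fin n1)) (S2 : Finset (Fin n2)),
    S1.card + S2.card = r ∧ ∀ p ∈ pivotSet 𝒜, p.1 ∈ S1 ∨ p.2 ∈ S2}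

/-- The border subrank `Q̲(T)`: the largest `r` such that, over Laurent polynomials
in `ε`, some restriction of `T` equals `⟨r⟩ + ε S_1 + ⋯ + ε^t S_t`. -/
noncomputable def borderSubrank {ι1 ι2 ι3 : Type*} [Fintype ι1] [Fintype ι2] [Fintype ι3]
    (T : ι1 → ι2 → ι3 → F) : ℕ :=
  sSup {r : ℕ |
    ∃ (A : Fin r → ι1 → LaurentPolynomial F) (B : Fin r → ι2 → LaurentPolynomial F)
      (C : Fin r → ι3 → LaurentPolynomial F) (t : ℕ)
      (S : Fin t → (Fin r → Fin r → Fin r → F)),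
      ∀ a b c,
        (∑ i, ∑ j, ∑ k, A a i * B b j * C c k * LaurentPolynomial.C (T i j k)) =
          LaurentPolynomial.C (unitTensor F r a b c) +
            ∑ s : Fin t, LaurentPolynomial.T (((s : ℕ) : ℤ) + 1) *
              LaurentPolynomial.C (S s a b c)}

/-- The linear map `A ↦ U * A * V` on rectangular matrices. -/
def conjMap {n1 n2 : ℕ} (U : Matrix (Fin n1) (Fin n1) F) (V : Matrix (Fin n2) (Fin n2) F) :
    Matrix (Fin n1) (Fin n2) F →ₗ[F] Matrix (Fin n1) (Fin n2) F where
  toFun A := U * A * V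
  map_add' A B := by simp [Matrix.mul_add, Matrix.add_mul]
  map_smul' c A := by simp [Matrix.mul_smul, Matrix.smul_mul]

/-- The principal submatrix `A_{J×J}`, where `J ⊆ [min{n1,n2}]` is encoded by the
map `η`. -/
def restrictJJ {n1 n2 jn : ℕ} (η : Fin jn → Fin (min n1 n2))
    (A : Matrix (Fin n1) (Fin n2) F) : Matrix (Fin jn) (Fin jn) F :=
  Matrix.of fun p q =>
    A (Fin.castLE (min_le_left n1 n2) (η p)) (Fin.castLE (min_le_right n1 n2) (η q))

/-- An order-three tensor over `F` of arbitrary format. -/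
structure Tensor3 (F : Type*) [Field F] where
  n1 : ℕ
  n2 : ℕ
  n3 : ℕ
  coef : Fin n1 → Fin n2 → Fin n3 → F

/-- Two tensors are equivalent if each restricts to the other. -/
def Tensor3.Equivalent (T S : Tensor3 F) : Prop :=
  Restricts T.coef S.coef ∧ Restricts S.coef T.coef

/-- A rank-one order-`k` tensor: a tensor product of `k` nonzero vectors. -/
def RankOne {k : ℕ} {ι : Fin k → Type*} (T : ((i : Fin k) → ι i) → F) : Prop :=
  ∃ u : (i : Fin k) → (ι i → F), (∀ i, u i ≠ 0) ∧ ∀ v, T v = ∏ i, u i (v i)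

/-- The tensor rank of an order-`k` tensor. -/
noncomputable def tensorRank {k : ℕ} {ι : Fin k → Type*} (T : ((i : Fin k) → ι i) → F) : ℕ :=
  sInf {r : ℕ | ∃ f : Fin r → (((i : Fin k) → ι i) → F),
    (∀ t, RankOne (f t)) ∧ T = ∑ t, f t}

/-- Kronecker power of an order-`k` tensor. -/
def kronPowK {k : ℕ} {ι : Fin k → Type*} (T : ((i : Fin k) → ι i) → F) (m : ℕ) :
    ((i : Fin k) → (Fin m → ι i)) → F :=
  fun v => ∏ s : Fin m, T fun i => v i s

/-- The asymptotic rank `R~(T) = lim_n R(T^{⊠n})^{1/n} = inf_n R(T^{⊠n})^{1/n}`. -/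
noncomputable def asympRank {k : ℕ} {ι : Fin k → Type*} (T : ((i : Fin k) → ι i) → F) : ℝ :=
  ⨅ m : ℕ, (tensorRank (kronPowK T (m + 1)) : ℝ) ^ ((1 : ℝ) / (m + 1))

section LinearAlgebra

variable {X Y Z : Type*} [AddCommGroup X] [Module F X] [AddCommGroup Y] [Module F Y]
  [AddCommGroup Z] [Module F Z]

open Module

theorem finrank_finset_sup_le [FiniteDimensional F Z] {ι : Type*} (s : Finset ι)
    (f : ι → Submodule F Z) {d : ℕ} (h : ∀ i, finrank F (f i) ≤ d) :
    finrank F (s.sup f : Submodule F Z) ≤ s.card * d := by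
  classical
  induction s using Finset.induction_on with
  | empty => simp
  | insert a s ha ih =>
    rw [Finset.sup_insert, Finset.card_insert_of_notMem ha]
    have h1 := Submodule.finrank_add_le_finrank_add_finrank (f a) (s.sup f)
    have h2 := h a
    rw [add_mul, one_mul]
    omega

/-- If all partial maps `B x` have rank at most `r` and all partial maps `B.flip y` have rank at
most `s`, then the values of `B` span a space of dimension at most `r ^ 2 * s`. -/
theorem finrank_iSup_range_le [FiniteDimensional F Y] (s : ℕ) (r : ℕ) :
    ∀ {Z : Type*} [AddCommGroup Z] [Module F Z] [FiniteDimensional F Z] (B : X →ₗ[F] Y →ₗ[F] Z),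
      (∀ x, finrank F (LinearMap.range (B x)) ≤ r) →
      (∀ y, finrank F (LinearMap.range (B.flip y)) ≤ s) →
      finrank F (⨆ x, LinearMap.range (B x) : Submodule F Z) ≤ r ^ 2 * s := by
  induction r with
  | zero =>
    intro Z _ _ _ B hB _
    have : ∀ x, LinearMap.range (B x) = ⊥ := fun x =>
      Submodule.finrank_eq_zero.mp (Nat.le_zero.mp (hB x))
    simp [this]
  | succ r ih =>
    intro Z _ _ _ B hB hB'
    by_cases hr : ∀ x, finrank F (LinearMap.range (B x)) ≤ r
    · exact (ih B hr hB').trans (Nat.mul_le_mul_right _ (Nat.pow_le_pow_left (by omega) 2))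
    push Not at hr
    obtain ⟨x₀, hx₀⟩ := hr
    have hx₀ : finrank F (LinearMap.range (B x₀)) = r + 1 := le_antisymm (hB x₀) hx₀
    obtain ⟨C, hC⟩ := (LinearMap.ker (B x₀)).exists_isCompl
    have hCr : finrank F C = r + 1 := by
      have h1 := Submodule.finrank_add_eq_of_isCompl hC
      have h2 := LinearMap.finrank_range_add_finrank_ker (B x₀)
      omega
    let b := Module.finBasis F C
    set Y' : Submodule F Z := Finset.univ.sup fun i => LinearMap.range (B.flip (b i : Y)) with hY'
    have hY'card : finrank F Y' ≤ (r + 1) * s := by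
      have := finrank_finset_sup_le Finset.univ
        (fun i => LinearMap.range (B.flip (b i : Y))) (fun i => hB' _)
      simpa [hCr] using this
    have hmem : ∀ c ∈ C, ∀ x, B x c ∈ Y' := by
      intro c hc x
      have hsum : c = ∑ i, b.repr ⟨c, hc⟩ i • (b i : Y) := by
        have := congrArg C.subtype (b.sum_repr ⟨c, hc⟩)
        rw [map_sum] at this
        exact this.symm
      rw [hsum, map_sum]
      refine Submodule.sum_mem _ fun i _ => ?_
      rw [map_smul]
      refine Submodule.smul_mem _ _ ?_
      exact (Finset.le_sup (f := fun i => LinearMap.range (B.flip (b i : Y)))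
        (Finset.mem_univ i)) ⟨x, rfl⟩
    have hsplit : ∀ y, ∃ k ∈ LinearMap.ker (B x₀), ∃ c ∈ C, k + c = y := fun y =>
      Submodule.mem_sup.mp (hC.sup_eq_top ▸ Submodule.mem_top)
    have hlow : ∀ x, finrank F (LinearMap.range (B.compr₂ Y'.mkQ x)) ≤ r := by
      intro x
      by_contra! hlt
      have hr1 : LinearMap.range (B.compr₂ Y'.mkQ x) = (LinearMap.range (B x)).map Y'.mkQ := by
        rw [← LinearMap.range_comp]; rfl
      have hrk := LinearMap.finrank_range_add_finrank_ker
        (Y'.mkQ.domRestrict (LinearMap.range (B x)))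
      have hr2 : LinearMap.range (Y'.mkQ.domRestrict (LinearMap.range (B x)))
          = LinearMap.range (B.compr₂ Y'.mkQ x) := by
        rw [hr1, LinearMap.range_domRestrict]
      rw [hr2] at hrk
      have hBx := hB x
      have hker : LinearMap.ker (Y'.mkQ.domRestrict (LinearMap.range (B x))) = ⊥ :=
        Submodule.finrank_eq_zero.mp (by omega)
      have hinj : ∀ y, B x y ∈ Y' → B x y = 0 := by
        intro y hy
        have : (⟨B x y, ⟨y, rfl⟩⟩ : LinearMap.range (B x)) ∈
            LinearMap.ker (Y'.mkQ.domRestrict (LinearMap.range (B x))) := by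
          rw [LinearMap.mem_ker, LinearMap.domRestrict_apply, Submodule.mkQ_apply]
          exact (Submodule.Quotient.mk_eq_zero _).mpr hy
        rw [hker, Submodule.mem_bot] at this
        exact congrArg Subtype.val this
      have hx0Y : LinearMap.range (B x₀) ≤ Y' := by
        rintro _ ⟨y, rfl⟩
        obtain ⟨k, hk, c, hc, rfl⟩ := hsplit y
        rw [map_add, LinearMap.mem_ker.mp hk, zero_add]
        exact hmem c hc x₀
      have hdisj : Disjoint (LinearMap.range (B x₀)) (LinearMap.range (B x)) := by
        rw [Submodule.disjoint_def]
        rintro _ h ⟨y, rfl⟩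
        exact hinj y (hx0Y h)
      have hsub : LinearMap.range (B x₀) ⊔ LinearMap.range (B x)
          ≤ LinearMap.range (B (x₀ + x)) := by
        refine sup_le ?_ ?_
        · rintro _ ⟨y, rfl⟩
          obtain ⟨k, hk, c, hc, rfl⟩ := hsplit y
          refine ⟨c, ?_⟩
          simp [LinearMap.mem_ker.mp hk, hinj c (hmem c hc x)]
        · rintro _ ⟨y, rfl⟩
          obtain ⟨k, hk, c, hc, rfl⟩ := hsplit y
          refine ⟨k, ?_⟩
          simp [LinearMap.mem_ker.mp hk, hinj c (hmem c hc x)]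
      have h1 := Submodule.finrank_mono hsub
      have h2 := Submodule.finrank_sup_add_finrank_inf_eq (LinearMap.range (B x₀))
        (LinearMap.range (B x))
      rw [hdisj.eq_bot, finrank_bot] at h2
      have h3 := hB (x₀ + x)
      omega
    have hflip : ∀ y, finrank F (LinearMap.range ((B.compr₂ Y'.mkQ).flip y)) ≤ s := by
      intro y
      have : (B.compr₂ Y'.mkQ).flip y = Y'.mkQ ∘ₗ B.flip y := rfl
      rw [this, LinearMap.range_comp]
      exact (Submodule.finrank_map_le _ _).trans (hB' y)
    have hQ := ih (B.compr₂ Y'.mkQ) hlow hflip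
    have hmap : (⨆ x, LinearMap.range (B.compr₂ Y'.mkQ x))
        = (⨆ x, LinearMap.range (B x)).map Y'.mkQ := by
      rw [Submodule.map_iSup]
      refine iSup_congr fun x => ?_
      rw [← LinearMap.range_comp]; rfl
    rw [hmap] at hQ
    set W := ⨆ x, LinearMap.range (B x)
    have hrk := LinearMap.finrank_range_add_finrank_ker (Y'.mkQ.domRestrict W)
    rw [LinearMap.range_domRestrict] at hrk
    have hkW : finrank F (LinearMap.ker (Y'.mkQ.domRestrict W)) ≤ finrank F Y' := by
      let g : LinearMap.ker (Y'.mkQ.domRestrict W) →ₗ[F] Y' :=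
        LinearMap.codRestrict Y' (W.subtype ∘ₗ Submodule.subtype _) (by
          rintro ⟨w, hw⟩
          rw [LinearMap.mem_ker, LinearMap.domRestrict_apply, Submodule.mkQ_apply] at hw
          exact (Submodule.Quotient.mk_eq_zero _).mp hw)
      refine LinearMap.finrank_le_finrank_of_injective (f := g) fun a b hab => ?_
      have := congrArg Subtype.val hab
      exact Subtype.ext (Subtype.ext this)
    have : r ^ 2 * s + (r + 1) * s ≤ (r + 1) ^ 2 * s := by
      rw [← add_mul]
      exact Nat.mul_le_mul_right _ (by nlinarith)
    omega

/-- If `f` is injective and vanishes on `ker Φ × ker Ψ`, then `X` is small. -/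
theorem finrank_le_of_vanish [FiniteDimensional F X] [FiniteDimensional F Y]
    [FiniteDimensional F Z] {A B : Type*} [AddCommGroup A] [Module F A] [FiniteDimensional F A]
    [AddCommGroup B] [Module F B] [FiniteDimensional F B]
    (f : X →ₗ[F] Y →ₗ[F] Z) (hf : Function.Injective f) (Φ : X →ₗ[F] A) (Ψ : Y →ₗ[F] B)
    (h : ∀ x, Φ x = 0 → ∀ y, Ψ y = 0 → f x y = 0) :
    finrank F X ≤ finrank F A + finrank F B * finrank F Z := by
  let P : (B →ₗ[F] Z) →ₗ[F] (Y →ₗ[F] Z) := LinearMap.lcomp F Z Ψ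
  have hsub : (LinearMap.ker Φ).map f ≤ LinearMap.range P := by
    rintro _ ⟨x, hx, rfl⟩
    obtain ⟨C, hC⟩ := (LinearMap.ker Ψ).exists_isCompl
    have hinj : LinearMap.ker (Ψ.domRestrict C) = ⊥ := by
      rw [LinearMap.ker_eq_bot']
      rintro ⟨c, hc⟩ h0
      have : c ∈ LinearMap.ker Ψ ⊓ C := ⟨h0, hc⟩
      rw [hC.inf_eq_bot, Submodule.mem_bot] at this
      exact Subtype.ext this
    obtain ⟨g, hg⟩ := LinearMap.exists_leftInverse_of_injective _ hinj
    refine ⟨f x ∘ₗ C.subtype ∘ₗ g, ?_⟩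
    ext y
    obtain ⟨k, hk, c, hc, rfl⟩ : ∃ k ∈ LinearMap.ker Ψ, ∃ c ∈ C, k + c = y :=
      Submodule.mem_sup.mp (hC.sup_eq_top ▸ Submodule.mem_top)
    have h1 : g (Ψ c) = ⟨c, hc⟩ := LinearMap.congr_fun hg ⟨c, hc⟩
    have h2 : Ψ k = 0 := hk
    simp [P, h1, h2, h x hx k hk]
  have h1 := LinearMap.finrank_range_add_finrank_ker Φ
  have h2 := Submodule.finrank_le (LinearMap.range Φ)
  have h3 := Submodule.finrank_mono hsub
  rw [← (Submodule.equivMapOfInjective f hf _).finrank_eq] at h3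
  have h4 := LinearMap.finrank_range_le P
  rw [Module.finrank_linearMap] at h4
  omega

/-- A linearly independent family of coordinate vectors has a dual family. -/
theorem exists_dual_family {κ ι : Type*} [Fintype κ] [DecidableEq κ] [Fintype ι]
    (v : κ → ι → F) (hv : LinearIndependent F v) :
    ∃ d : κ → ι → F, ∀ a b, ∑ k, d a k * v b k = if a = b then 1 else 0 := by
  classical
  obtain ⟨g, hg⟩ := LinearMap.exists_leftInverse_of_injective (Fintype.linearCombination F v)
    (LinearMap.ker_eq_bot.mpr (linearIndependent_iff_injective_fintypeLinearCombination.mp hv))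
  refine ⟨fun a k => g (Pi.single k 1) a, fun a b => ?_⟩
  have h1 : g (v b) = Pi.single b 1 := by
    have := LinearMap.congr_fun hg (Pi.single b 1)
    simpa using this
  have h2 : v b = ∑ k, v b k • (Pi.single k 1 : ι → F) := by
    ext k; simp [Finset.sum_apply, Pi.single_apply]
  have h3 : g (v b) a = ∑ k, g (Pi.single k 1) a * v b k := by
    conv_lhs => rw [h2]
    simp [map_sum, Finset.sum_apply, mul_comm]
  rw [← h3, h1, Pi.single_apply]

end LinearAlgebra

section Restriction

variable {ι1 ι2 ι3 κ1 κ2 κ3 μ1 μ2 μ3 : Type*} [Fintype ι1] [Fintype ι2]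

/-- The bilinear map contracting the first two directions of a tensor. -/
def bil (T : ι1 → ι2 → ι3 → F) : (ι1 → F) →ₗ[F] (ι2 → F) →ₗ[F] (ι3 → F) :=
  LinearMap.mk₂ F (fun x y k => ∑ i, ∑ j, x i * y j * T i j k)
    (fun x x' y => by ext k; simp [add_mul, Finset.sum_add_distrib])
    (fun c x y => by ext k; simp [Finset.mul_sum, mul_assoc])
    (fun x y y' => by ext k; simp [mul_add, add_mul, Finset.sum_add_distrib])
    (fun c x y => by
      ext k
      simp only [Pi.smul_apply, smul_eq_mul, Finset.mul_sum]
      exact Finset.sum_congr rfl fun i _ => Finset.sum_congr rfl fun j _ => by ring)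

theorem bil_apply (T : ι1 → ι2 → ι3 → F) (x : ι1 → F) (y : ι2 → F) (k : ι3) :
    bil T x y k = ∑ i, ∑ j, x i * y j * T i j k := rfl

theorem bil_single [DecidableEq ι1] [DecidableEq ι2] (T : ι1 → ι2 → ι3 → F) (i : ι1) (j : ι2) :
    bil T (Pi.single i 1) (Pi.single j 1) = T i j := by
  ext k
  simp [bil_apply, Pi.single_apply]

theorem bil_bil [Fintype κ1] [Fintype κ2] (T : ι1 → ι2 → ι3 → F) (L1 : κ1 → ι1 → F)
    (L2 : κ2 → ι2 → F) (x : κ1 → F) (y : κ2 → F) :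
    bil T (∑ a, x a • L1 a) (∑ b, y b • L2 b) = ∑ a, ∑ b, (x a * y b) • bil T (L1 a) (L2 b) := by
  simp only [map_sum, map_smul, LinearMap.sum_apply, LinearMap.smul_apply, Finset.smul_sum,
    smul_smul]
  rw [Finset.sum_comm]
  simp only [mul_comm]

theorem bil_kronPow (T : ι1 → ι2 → ι3 → F) (m : ℕ) (a : Fin m → ι1 → F) (b : Fin m → ι2 → F)
    (z : Fin m → ι3) :
    bil (kronPow T m) (fun x => ∏ s, a s (x s)) (fun y => ∏ s, b s (y s)) z
      = ∏ s, bil T (a s) (b s) (z s) := by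
  classical
  simp only [bil_apply, Finset.prod_univ_sum, Fintype.piFinset_univ, kronPow,
    Finset.prod_mul_distrib]

variable [Fintype ι3]

theorem sum_mul_bil (T : ι1 → ι2 → ι3 → F) (x : ι1 → F) (y : ι2 → F) (z : ι3 → F) :
    ∑ k, z k * bil T x y k = ∑ i, ∑ j, ∑ k, x i * y j * z k * T i j k := by
  simp only [bil_apply, Finset.mul_sum]
  rw [Finset.sum_comm]
  refine Finset.sum_congr rfl fun i _ => ?_
  rw [Finset.sum_comm]
  exact Finset.sum_congr rfl fun j _ => Finset.sum_congr rfl fun k _ => by ring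

theorem restricts_iff_bil (T : ι1 → ι2 → ι3 → F) (S : κ1 → κ2 → κ3 → F) :
    Restricts T S ↔ ∃ (L1 : κ1 → ι1 → F) (L2 : κ2 → ι2 → F) (L3 : κ3 → ι3 → F),
      ∀ a b c, S a b c = ∑ k, L3 c k * bil T (L1 a) (L2 b) k := by
  simp only [sum_mul_bil]
  rfl

theorem Restricts.trans [Fintype κ1] [Fintype κ2] [Fintype κ3] {T : ι1 → ι2 → ι3 → F}
    {S : κ1 → κ2 → κ3 → F} {R : μ1 → μ2 → μ3 → F}
    (h : Restricts T S) (h' : Restricts S R) : Restricts T R := by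
  rw [restricts_iff_bil] at h h' ⊢
  obtain ⟨L1, L2, L3, hL⟩ := h
  obtain ⟨M1, M2, M3, hM⟩ := h'
  have key : ∀ x y c, bil S x y c =
      ∑ k, L3 c k * bil T (∑ i, x i • L1 i) (∑ i, y i • L2 i) k := by
    intro x y c
    rw [bil_bil]
    simp only [bil_apply S, hL, Finset.sum_apply, Pi.smul_apply, smul_eq_mul, Finset.mul_sum]
    symm
    rw [Finset.sum_comm]
    refine Finset.sum_congr rfl fun i _ => ?_
    rw [Finset.sum_comm]
    exact Finset.sum_congr rfl fun j _ => Finset.sum_congr rfl fun k _ => by ring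
  refine ⟨fun a => ∑ i, M1 a i • L1 i, fun b => ∑ i, M2 b i • L2 i,
    fun c => ∑ i, M3 c i • L3 i, fun a b c => ?_⟩
  simp only [hM, key, Finset.sum_apply, Pi.smul_apply, smul_eq_mul, Finset.sum_mul,
    Finset.mul_sum]
  rw [Finset.sum_comm]
  simp only [mul_assoc]

theorem sum_mul_bil_kronPow (T : ι1 → ι2 → ι3 → F) (m : ℕ) (a : Fin m → ι1 → F)
    (b : Fin m → ι2 → F) (c : Fin m → ι3 → F) :
    ∑ z, (∏ s, c s (z s)) * bil (kronPow T m) (fun x => ∏ s, a s (x s))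
      (fun y => ∏ s, b s (y s)) z = ∏ s, ∑ k, c s k * bil T (a s) (b s) k := by
  classical
  simp only [bil_kronPow, Finset.prod_univ_sum, Fintype.piFinset_univ, Finset.prod_mul_distrib]

theorem Restricts.kronPow {T : ι1 → ι2 → ι3 → F} {S : κ1 → κ2 → κ3 → F} (h : Restricts T S)
    (m : ℕ) : Restricts (kronPow T m) (kronPow S m) := by
  rw [restricts_iff_bil] at h ⊢
  obtain ⟨L1, L2, L3, hL⟩ := h
  refine ⟨fun a x => ∏ s, L1 (a s) (x s), fun a x => ∏ s, L2 (a s) (x s),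
    fun a x => ∏ s, L3 (a s) (x s), fun a b c => ?_⟩
  rw [sum_mul_bil_kronPow T m (fun s => L1 (a s)) (fun s => L2 (b s)) (fun s => L3 (c s))]
  simp only [← hL]
  rfl

theorem Restricts.swap12 {T : ι1 → ι2 → ι3 → F} {S : κ1 → κ2 → κ3 → F} (h : Restricts T S) :
    Restricts (fun j i k => T i j k) (fun j i k => S i j k) := by
  obtain ⟨L1, L2, L3, hL⟩ := h
  refine ⟨L2, L1, L3, fun a b c => ?_⟩
  change S b a c = _
  rw [hL, Finset.sum_comm]
  exact Finset.sum_congr rfl fun i _ => Finset.sum_congr rfl fun j _ =>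
    Finset.sum_congr rfl fun k _ => by ring

theorem Restricts.swap23 {T : ι1 → ι2 → ι3 → F} {S : κ1 → κ2 → κ3 → F} (h : Restricts T S) :
    Restricts (fun i k j => T i j k) (fun i k j => S i j k) := by
  obtain ⟨L1, L2, L3, hL⟩ := h
  refine ⟨L1, L3, L2, fun a b c => ?_⟩
  change S a c b = _
  rw [hL]
  refine Finset.sum_congr rfl fun i _ => ?_
  rw [Finset.sum_comm]
  exact Finset.sum_congr rfl fun j _ => Finset.sum_congr rfl fun k _ => by ring

theorem unitTensor_swap12 (r : ℕ) : (fun j i k => unitTensor F r i j k) = unitTensor F r := by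
  ext i j k
  simp only [unitTensor]
  congr 1
  grind

theorem unitTensor_swap23 (r : ℕ) : (fun i k j => unitTensor F r i j k) = unitTensor F r := by
  ext i j k
  simp only [unitTensor]
  congr 1
  grind

theorem le_card_of_restricts_unitTensor {T : ι1 → ι2 → ι3 → F} {r : ℕ}
    (h : Restricts T (unitTensor F r)) : r ≤ Fintype.card ι3 := by
  rw [restricts_iff_bil] at h
  obtain ⟨L1, L2, L3, hL⟩ := h
  have hli : LinearIndependent F L3 := by
    rw [Fintype.linearIndependent_iff]
    intro g hg c
    have h1 : ∑ a, g a * unitTensor F r c c a = 0 := by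
      have h2 : ∀ k, ∑ a, g a * L3 a k = 0 := fun k => by
        simpa using congrFun hg k
      simp only [hL, Finset.mul_sum]
      rw [Finset.sum_comm]
      refine Finset.sum_eq_zero fun k _ => ?_
      simp only [← mul_assoc]
      rw [← Finset.sum_mul, h2, zero_mul]
    simpa [unitTensor] using h1
  simpa using hli.fintype_card_le_finrank

theorem bddAbove_restricts_unitTensor (T : ι1 → ι2 → ι3 → F) :
    BddAbove {r : ℕ | Restricts T (unitTensor F r)} :=
  ⟨Fintype.card ι3, fun _ h => le_card_of_restricts_unitTensor h⟩

theorem le_subrank {T : ι1 → ι2 → ι3 → F} {r : ℕ} (h : Restricts T (unitTensor F r)) :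
    r ≤ subrank T :=
  le_csSup (bddAbove_restricts_unitTensor T) h

theorem subrank_le_card (T : ι1 → ι2 → ι3 → F) : subrank T ≤ Fintype.card ι3 :=
  csSup_le' fun _ h => le_card_of_restricts_unitTensor h

theorem Restricts.subrank_le [Fintype κ1] [Fintype κ2] [Fintype κ3]
    {T : ι1 → ι2 → ι3 → F} {S : κ1 → κ2 → κ3 → F}
    (h : Restricts T S) : subrank S ≤ subrank T :=
  csSup_le' fun _ hr => le_subrank (h.trans hr)

theorem subrank_swap12 (T : ι1 → ι2 → ι3 → F) : subrank (fun j i k => T i j k) = subrank T := by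
  unfold subrank
  congr 1
  ext r
  simp only [Set.mem_ofPred_eq]
  constructor <;> intro h
  all_goals
    have h' := h.swap12
    rwa [unitTensor_swap12] at h'

theorem subrank_swap23 (T : ι1 → ι2 → ι3 → F) : subrank (fun i k j => T i j k) = subrank T := by
  unfold subrank
  congr 1
  ext r
  simp only [Set.mem_ofPred_eq]
  constructor <;> intro h
  all_goals
    have h' := h.swap23
    rwa [unitTensor_swap23] at h'

theorem asympSubrank_swap12 (T : ι1 → ι2 → ι3 → F) :
    asympSubrank (fun j i k => T i j k) = asympSubrank T := by
  unfold asympSubrank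
  congr 1
  ext m
  rw [← subrank_swap12 (Paper.kronPow T (m + 1))]
  rfl

theorem asympSubrank_swap23 (T : ι1 → ι2 → ι3 → F) :
    asympSubrank (fun i k j => T i j k) = asympSubrank T := by
  unfold asympSubrank
  congr 1
  ext m
  rw [← subrank_swap23 (Paper.kronPow T (m + 1))]
  rfl

theorem subrank_kronPow_rpow_le (T : ι1 → ι2 → ι3 → F) (m : ℕ) :
    (subrank (Paper.kronPow T (m + 1)) : ℝ) ^ ((1 : ℝ) / (m + 1)) ≤ Fintype.card ι3 := by
  have h1 : (subrank (Paper.kronPow T (m + 1)) : ℝ) ≤ (Fintype.card ι3 : ℝ) ^ (m + 1) := by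
    exact_mod_cast (subrank_le_card (Paper.kronPow T (m + 1))).trans (by simp)
  calc _ ≤ ((Fintype.card ι3 : ℝ) ^ (m + 1)) ^ ((1 : ℝ) / (m + 1)) :=
        Real.rpow_le_rpow (by positivity) h1 (by positivity)
    _ = Fintype.card ι3 := by
        have := Real.pow_rpow_inv_natCast (n := m + 1)
          (Nat.cast_nonneg (α := ℝ) (Fintype.card ι3)) (by omega)
        rw [one_div]
        exact_mod_cast this

theorem asympSubrank_le_card (T : ι1 → ι2 → ι3 → F) : asympSubrank T ≤ Fintype.card ι3 :=
  ciSup_le fun m => subrank_kronPow_rpow_le T m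

theorem subrank_rpow_le_asympSubrank (T : ι1 → ι2 → ι3 → F) (m : ℕ) :
    (subrank (Paper.kronPow T (m + 1)) : ℝ) ^ ((1 : ℝ) / (m + 1)) ≤ asympSubrank T :=
  le_ciSup (f := fun m : ℕ => (subrank (Paper.kronPow T (m + 1)) : ℝ) ^ ((1 : ℝ) / (m + 1)))
    ⟨Fintype.card ι3, by rintro _ ⟨m, rfl⟩; exact subrank_kronPow_rpow_le T m⟩ m

theorem asympSubrank_nonneg (T : ι1 → ι2 → ι3 → F) : 0 ≤ asympSubrank T :=
  le_trans (by positivity) (subrank_rpow_le_asympSubrank T 0)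

theorem subrank_kronPow_le_asympSubrank_pow (T : ι1 → ι2 → ι3 → F) (m : ℕ) :
    (subrank (Paper.kronPow T (m + 1)) : ℝ) ≤ asympSubrank T ^ (m + 1) := by
  have h := pow_le_pow_left₀ (by positivity) (subrank_rpow_le_asympSubrank T m) (m + 1)
  refine le_trans (le_of_eq ?_) h
  have := Real.rpow_inv_natCast_pow (n := m + 1)
    (Nat.cast_nonneg (α := ℝ) (subrank (Paper.kronPow T (m + 1)))) (by omega)
  rw [one_div]
  exact_mod_cast this.symm

theorem Restricts.asympSubrank_le [Fintype κ1] [Fintype κ2] [Fintype κ3]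
    {T : ι1 → ι2 → ι3 → F} {S : κ1 → κ2 → κ3 → F}
    (h : Restricts T S) : asympSubrank S ≤ asympSubrank T :=
  ciSup_le fun m => (Real.rpow_le_rpow (by positivity)
    (Nat.cast_le.mpr (h.kronPow (m + 1)).subrank_le) (by positivity)).trans
    (subrank_rpow_le_asympSubrank T m)

end Restriction

section RankDichotomy

variable {ι1 ι2 ι3 : Type*} [Fintype ι3]

/-- The identity matrix of size `q`, seen as a tensor with trivial first direction. -/
def identTensor1 (F : Type*) [Field F] (q : ℕ) : Unit → Fin q → Fin q → F :=
  fun _ b c => if b = c then 1 else 0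

/-- The identity matrix of size `q`, seen as a tensor with trivial second direction. -/
def identTensor2 (F : Type*) [Field F] (q : ℕ) : Fin q → Unit → Fin q → F :=
  fun a _ c => if a = c then 1 else 0

/-- The identity matrix of size `q`, seen as a tensor with trivial third direction. -/
def identTensor3 (F : Type*) [Field F] (q : ℕ) : Fin q → Fin q → Unit → F :=
  fun a b _ => if a = b then 1 else 0

theorem span_range_eq_top {T : ι1 → ι2 → ι3 → F}
    (h3 : LinearIndependent F fun k i j => T i j k) :
    Submodule.span F (Set.range fun p : ι1 × ι2 => T p.1 p.2) = ⊤ := by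
  classical
  by_contra hne
  obtain ⟨f, hf0, hf⟩ := Submodule.exists_le_ker_of_lt_top _ (lt_top_iff_ne_top.mpr hne)
  rw [Fintype.linearIndependent_iff] at h3
  have hfv : ∀ v : ι3 → F, f v = ∑ k, f (Pi.single k 1) * v k := fun v => by
    rw [f.pi_apply_eq_sum_univ v]
    refine Finset.sum_congr rfl fun k _ => ?_
    rw [smul_eq_mul, mul_comm]
    congr 2
    ext j
    simp [Pi.single_apply, eq_comm]
  have hz : ∀ k, f (Pi.single k 1) = 0 := h3 (fun k => f (Pi.single k 1)) (by
    ext i j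
    have : f (T i j) = 0 := hf (Submodule.subset_span ⟨(i, j), rfl⟩)
    rw [hfv] at this
    simpa using this)
  exact hf0 (LinearMap.ext fun v => by
    rw [hfv]
    simp only [hz, zero_mul, Finset.sum_const_zero, LinearMap.zero_apply])

theorem exists_dual_of_le_finrank_range {Y : Type*} [AddCommGroup Y] [Module F Y]
    (f : Y →ₗ[F] ι3 → F) {q : ℕ} (hq : q ≤ Module.finrank F (LinearMap.range f)) :
    ∃ (y : Fin q → Y) (z : Fin q → ι3 → F),
      ∀ b c, ∑ k, z c k * f (y b) k = if b = c then 1 else 0 := by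
  classical
  obtain ⟨v, hv⟩ := exists_linearIndependent_of_le_finrank hq
  choose y hy using fun b => (v b).2
  have hv' : LinearIndependent F fun b => (v b : ι3 → F) :=
    hv.map' (LinearMap.range f).subtype (Submodule.ker_subtype _)
  obtain ⟨z, hz⟩ := exists_dual_family _ hv'
  refine ⟨y, z, fun b c => ?_⟩
  simp only [hy, hz, eq_comm]

variable [Fintype ι1] [Fintype ι2]

theorem restricts_identTensor_or {T : ι1 → ι2 → ι3 → F}
    (h3 : LinearIndependent F fun k i j => T i j k) {r : ℕ} (hr : r ^ 2 * r < Fintype.card ι3) :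
    Restricts T (identTensor1 F (r + 1)) ∨ Restricts T (identTensor2 F (r + 1)) := by
  classical
  have htop : (⨆ x, LinearMap.range (bil T x)) = ⊤ := by
    rw [eq_top_iff, ← span_range_eq_top h3, Submodule.span_le]
    rintro _ ⟨p, rfl⟩
    refine Submodule.mem_iSup_of_mem (Pi.single p.1 1) ⟨Pi.single p.2 1, ?_⟩
    exact bil_single T p.1 p.2
  by_cases h1 : ∀ x, Module.finrank F (LinearMap.range (bil T x)) ≤ r
  · by_cases h2 : ∀ y, Module.finrank F (LinearMap.range ((bil T).flip y)) ≤ r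
    · have := finrank_iSup_range_le r r (bil T) h1 h2
      rw [htop, finrank_top, Module.finrank_fintype_fun_eq_card] at this
      omega
    · push Not at h2
      obtain ⟨y, hy⟩ := h2
      obtain ⟨x, z, hz⟩ := exists_dual_of_le_finrank_range _ hy
      refine Or.inr ((restricts_iff_bil _ _).mpr ⟨x, fun _ => y, z, fun a _ c => ?_⟩)
      exact (hz a c).symm
  · push Not at h1
    obtain ⟨x, hx⟩ := h1
    obtain ⟨y, z, hz⟩ := exists_dual_of_le_finrank_range _ hx
    refine Or.inl ((restricts_iff_bil _ _).mpr ⟨fun _ => x, y, z, fun _ b c => ?_⟩)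
    exact (hz b c).symm

theorem le_asympSubrank_sq_of_restricts {T : ι1 → ι2 → ι3 → F} {q : ℕ}
    (h1 : Restricts T (identTensor1 F q)) (h2 : Restricts T (identTensor2 F q)) :
    (q : ℝ) ≤ asympSubrank T ^ 2 := by
  rw [restricts_iff_bil] at h1 h2
  obtain ⟨x1, y1, z1, h1⟩ := h1
  obtain ⟨x2, y2, z2, h2⟩ := h2
  have hle : (subrank (kronPow T 2) : ℝ) ≤ asympSubrank T ^ 2 :=
    subrank_kronPow_le_asympSubrank_pow T 1
  refine le_trans ?_ hle
  refine Nat.cast_le.mpr (le_subrank ((restricts_iff_bil _ _).mpr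
    ⟨fun a p => ∏ s, (![x1 (), x2 a] : Fin 2 → ι1 → F) s (p s),
      fun b p => ∏ s, (![y1 b, y2 ()] : Fin 2 → ι2 → F) s (p s),
      fun c p => ∏ s, (![z1 c, z2 c] : Fin 2 → ι3 → F) s (p s), fun a b c => ?_⟩))
  rw [sum_mul_bil_kronPow]
  simp only [Fin.prod_univ_two, Matrix.cons_val_zero, Matrix.cons_val_one, ← h1, ← h2,
    identTensor1, identTensor2, unitTensor]
  grind

theorem le_asympSubrank_sq {T : ι1 → ι2 → ι3 → F} {r : ℕ}
    (h1 : LinearIndependent F T) (h2 : LinearIndependent F fun j i k => T i j k)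
    (h3 : LinearIndependent F fun k i j => T i j k)
    (hr1 : r ^ 2 * r < Fintype.card ι1) (hr2 : r ^ 2 * r < Fintype.card ι2)
    (hr3 : r ^ 2 * r < Fintype.card ι3) : ((r + 1 : ℕ) : ℝ) ≤ asympSubrank T ^ 2 := by
  have p12 := restricts_identTensor_or h3 hr3
  have p13 : Restricts T (identTensor1 F (r + 1)) ∨ Restricts T (identTensor3 F (r + 1)) :=
    (restricts_identTensor_or (T := fun i k j => T i j k) h2 hr2).imp
      (fun h => by
        convert h.swap23 using 1
        ext i j k
        simp [identTensor1, eq_comm])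
      (fun h => h.swap23)
  have p23 : Restricts T (identTensor2 F (r + 1)) ∨ Restricts T (identTensor3 F (r + 1)) :=
    (restricts_identTensor_or (T := fun j k i => T i j k) h1 hr1).imp
      (fun h => by
        convert h.swap23.swap12 using 1
        ext i j k
        simp [identTensor1, identTensor2, eq_comm])
      (fun h => by
        convert h.swap23.swap12 using 1
        ext i j k
        simp [identTensor2, identTensor3, eq_comm])
  by_cases q1 : Restricts T (identTensor1 F (r + 1))
  · by_cases q2 : Restricts T (identTensor2 F (r + 1))
    · exact le_asympSubrank_sq_of_restricts q1 q2
    · have q3 := p23.resolve_left q2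
      rw [← asympSubrank_swap23]
      refine le_asympSubrank_sq_of_restricts ?_ q3.swap23
      convert q1.swap23 using 1
      ext i j k
      simp [identTensor1, eq_comm]
  · have q2 := p12.resolve_left q1
    have q3 := p13.resolve_left q1
    rw [← asympSubrank_swap12, ← asympSubrank_swap23]
    refine le_asympSubrank_sq_of_restricts ?_ ?_
    · convert q2.swap12.swap23 using 1
      ext i j k
      simp [identTensor1, identTensor2, eq_comm]
    · convert q3.swap12.swap23 using 1
      ext i j k
      simp [identTensor2, identTensor3, eq_comm]

end RankDichotomy

section LargeTensor

theorem linearIndependent_of_le {W Ω : Type*} [Fintype W] [PartialOrder Ω] [WellFoundedLT Ω]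
    {f : W → Ω} (hf : Function.Injective f) (u : W → Ω → F) (h0 : ∀ w, u w (f w) ≠ 0)
    (hle : ∀ w z, u w z ≠ 0 → f w ≤ z) : LinearIndependent F u := by
  rw [Fintype.linearIndependent_iff]
  intro g hg
  suffices h : ∀ z w, f w = z → g w = 0 from fun w => h _ w rfl
  intro z
  induction z using WellFoundedLT.induction with
  | ind z ih =>
    rintro w rfl
    have h1 : ∑ w', g w' * u w' (f w) = 0 := by simpa using congrFun hg (f w)
    rw [Finset.sum_eq_single w] at h1
    · exact (mul_eq_zero.mp h1).resolve_right (h0 w)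
    · intro w' _ hw'
      by_cases hu : u w' (f w) = 0
      · rw [hu, mul_zero]
      · rw [ih (f w') (lt_of_le_of_ne (hle _ _ hu) fun h => hw' (hf h)) w' rfl, zero_mul]
    · simp

theorem card_le_subrank {W ι1 ι2 ι3 : Type*} [Fintype W] [Fintype ι1] [Fintype ι2] [Fintype ι3]
    (T : ι1 → ι2 → ι3 → F) (x : W → ι1 → F) (y : W → ι2 → F)
    (h0 : ∀ a b, a ≠ b → bil T (x a) (y b) = 0)
    (hli : LinearIndependent F fun a => bil T (x a) (y a)) : Fintype.card W ≤ subrank T := by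
  classical
  obtain ⟨d, hd⟩ := exists_dual_family _ hli
  let e := (Fintype.equivFin W).symm
  refine le_subrank ((restricts_iff_bil _ _).mpr
    ⟨fun a => x (e a), fun a => y (e a), fun a => d (e a), fun a b c => ?_⟩)
  by_cases hab : a = b
  · subst hab
    simp only [hd, e.apply_eq_iff_eq, unitTensor, true_and, eq_comm]
  · rw [h0 _ _ (fun h => hab (e.injective h))]
    simp [unitTensor, hab]

theorem card_words_le (c l : ℕ) (k : Fin c) :
    c ^ (c * l) ≤ Fintype.card {w : Fin (c * l) → Fin c //
      l ≤ (Finset.univ.filter fun t => w t = k).card} * c := by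
  have h : ∀ w : Fin (c * l) → Fin c, ∃ a, l ≤ (Finset.univ.filter fun t => w t = a).card := by
    intro w
    have : Nonempty (Fin c) := ⟨k⟩
    exact Fintype.exists_le_card_fiber_of_mul_le_card w (by simp)
  choose a ha using h
  let g : (Fin (c * l) → Fin c) → {w : Fin (c * l) → Fin c //
      l ≤ (Finset.univ.filter fun t => w t = k).card} × Fin c := fun w =>
    (⟨fun t => Equiv.swap (a w) k (w t), by
      refine (ha w).trans (Finset.card_le_card fun t ht => ?_)
      simp only [Finset.mem_filter, Finset.mem_univ, true_and] at ht ⊢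
      rw [ht, Equiv.swap_apply_left]⟩, a w)
  have hg : Function.Injective g := by
    intro w w' hw
    simp only [g, Prod.mk.injEq, Subtype.mk.injEq] at hw
    ext t
    have := congrFun hw.1 t
    rw [hw.2] at this
    exact congrArg _ ((Equiv.swap (a w') k).injective this)
  simpa using Fintype.card_le_of_injective g hg

theorem exists_separating_words {c l M : ℕ} (hM : c ^ c ≤ M) (hM0 : 0 < M)
    (P : Finset (Fin (c * l))) (hP : l ≤ P.card) :
    ∃ e : (Fin (c * l) → Fin c) → Fin (c * l) → Fin M,
      ∀ w w', w ≠ w' → ∃ t ∈ P, e w t ≠ e w' t := by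
  have : Nonempty (Fin M) := ⟨⟨0, hM0⟩⟩
  have hcard : Fintype.card (Fin (c * l) → Fin c) ≤ Fintype.card (P → Fin M) := by
    simp only [Fintype.card_fun, Fintype.card_fin, Fintype.card_coe, pow_mul]
    exact (Nat.pow_le_pow_left hM l).trans (Nat.pow_le_pow_right hM0 hP)
  obtain ⟨e⟩ := Function.Embedding.nonempty_of_card_le hcard
  refine ⟨fun w t => if h : t ∈ P then e w ⟨t, h⟩ else Classical.arbitrary _, fun w w' hw => ?_⟩
  obtain ⟨t, ht⟩ := Function.ne_iff.mp (fun h => hw (e.injective h))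
  exact ⟨t, t.2, by simpa using ht⟩

/-- A tensor whose diagonal contains, apart from the standard basis, many slices led by the same
basis vector has Kronecker powers of large subrank. -/
theorem pow_le_subrank_kronPow_mul {c M : ℕ} (hM : c ^ c ≤ M) (k : Fin c)
    (T : Fin c ⊕ Fin M → Fin c ⊕ Fin M → Fin c → F)
    (hll : ∀ a, T (.inl a) (.inl a) = Pi.single a 1) (hlr : ∀ a i, T (.inl a) (.inr i) = 0)
    (hrl : ∀ a i, T (.inr i) (.inl a) = 0) (hrr : ∀ i j, i ≠ j → T (.inr i) (.inr j) = 0)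
    (hk : ∀ i, T (.inr i) (.inr i) k ≠ 0) (hlt : ∀ i, ∀ a < k, T (.inr i) (.inr i) a = 0)
    (l : ℕ) : c ^ (c * l) ≤ subrank (kronPow T (c * l)) * c := by
  classical
  have hM0 : 0 < M := lt_of_lt_of_le (pow_pos (Fin.pos k) c) hM
  refine (card_words_le c l k).trans (Nat.mul_le_mul_right c ?_)
  let P : (Fin (c * l) → Fin c) → Finset (Fin (c * l)) := fun w =>
    Finset.univ.filter fun t => w t = k
  choose e he using exists_separating_words (c := c) (l := l) hM hM0
  let X : {w // l ≤ (P w).card} → Fin (c * l) → Fin c ⊕ Fin M := fun w t =>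
    if w.1 t = k then .inr (e (P w.1) w.2 w.1 t) else .inl (w.1 t)
  refine card_le_subrank (W := {w // l ≤ (P w).card}) (kronPow T (c * l))
    (fun w => Pi.single (X w) 1) (fun w => Pi.single (X w) 1) (fun w w' hw => ?_) ?_
  · rw [bil_single]
    have : ∃ t, T (X w t) (X w' t) = 0 := by
      by_cases hP : P w.1 = P w'.1
      · obtain ⟨t, ht, hne⟩ := he (P w.1) w.2 w.1 w'.1 (fun h => hw (Subtype.ext h))
        have ht' := ht
        rw [hP] at ht'
        simp only [P, Finset.mem_filter, Finset.mem_univ, true_and] at ht ht'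
        refine ⟨t, ?_⟩
        simp only [X, ht, ht', if_true]
        refine hrr _ _ ?_
        have hcongr : ∀ Q (hQ : l ≤ Q.card), P w.1 = Q →
            e (P w.1) w.2 w'.1 t = e Q hQ w'.1 t := by
          rintro Q hQ rfl
          rfl
        rwa [← hcongr _ w'.2 hP]
      · obtain ⟨t, ht⟩ : ∃ t, ¬ (w.1 t = k ↔ w'.1 t = k) := by
          by_contra hcon
          push Not at hcon
          exact hP (Finset.filter_congr fun t _ => hcon t)
        refine ⟨t, ?_⟩
        by_cases h : w.1 t = k <;> by_cases h' : w'.1 t = k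
        · exact absurd (iff_of_true h h') ht
        · simp only [X, h, h', if_true, if_false, hrl]
        · simp only [X, h, h', if_true, if_false, hlr]
        · exact absurd (iff_of_false h h') ht
    obtain ⟨t, ht⟩ := this
    ext z
    exact Finset.prod_eq_zero (Finset.mem_univ t) (by rw [ht]; rfl)
  · simp only [bil_single]
    refine linearIndependent_of_le Subtype.val_injective _ (fun w => ?_) (fun w z hz t => ?_)
    · refine Finset.prod_ne_zero_iff.mpr fun t _ => ?_
      by_cases h : w.1 t = k
      · simp only [X, h, if_true, hk, ne_eq, not_false_eq_true]
      · simp [X, h, hll]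
    · have ht := Finset.prod_ne_zero_iff.mp hz t (Finset.mem_univ t)
      by_cases h : w.1 t = k
      · simp only [X, h, if_true] at ht
        rw [h]
        by_contra hlt'
        exact ht (hlt _ _ (not_le.mp hlt'))
      · simp only [X, h, if_false, hll, Pi.single_apply] at ht
        by_contra hcon
        exact ht (if_neg fun hh => hcon hh.ge)

theorem exists_biorthogonal {X Y Z : Type*} [AddCommGroup X] [Module F X] [FiniteDimensional F X]
    [AddCommGroup Y] [Module F Y] [FiniteDimensional F Y] [AddCommGroup Z] [Module F Z]
    [FiniteDimensional F Z] (f : X →ₗ[F] Y →ₗ[F] Z) (hf : Function.Injective f) (K : ℕ)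
    (hK : K * Module.finrank F Z + K * Module.finrank F Z * Module.finrank F Z
      < Module.finrank F X) (n : ℕ) :
    ∀ s : Finset (X × Y), s.card + n ≤ K → ∃ (x : Fin n → X) (y : Fin n → Y),
      (∀ i, f (x i) (y i) ≠ 0) ∧ (∀ i j, i ≠ j → f (x i) (y j) = 0) ∧
        ∀ i, ∀ q ∈ s, f (x i) q.2 = 0 ∧ f q.1 (y i) = 0 := by
  classical
  induction n with
  | zero => exact fun s _ => ⟨Fin.elim0, Fin.elim0, fun i => i.elim0, fun i => i.elim0,
      fun i => i.elim0⟩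
  | succ n ih =>
    intro s hs
    obtain ⟨x, y, hxs, hys, hxy⟩ : ∃ x y, (∀ q ∈ s, f x q.2 = 0) ∧ (∀ q ∈ s, f q.1 y = 0) ∧
        f x y ≠ 0 := by
      by_contra! hcon
      have hle := finrank_le_of_vanish f hf
        (LinearMap.pi fun q : s => f.flip q.1.2) (LinearMap.pi fun q : s => f q.1.1)
        (fun x hx y hy => hcon x y (fun q hq => congrFun hx ⟨q, hq⟩)
          (fun q hq => congrFun hy ⟨q, hq⟩))
      simp only [Module.finrank_pi_fintype, Finset.sum_const, Finset.card_univ, Fintype.card_coe,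
        smul_eq_mul] at hle
      have hsK : s.card ≤ K := by omega
      have h1 := Nat.mul_le_mul_right (Module.finrank F Z) hsK
      have h2 := Nat.mul_le_mul_right (Module.finrank F Z) h1
      omega
    obtain ⟨x', y', hd, ho, hs'⟩ := ih (insert (x, y) s)
      (by have := Finset.card_insert_le (x, y) s; omega)
    refine ⟨Fin.cons x x', Fin.cons y y', ?_, ?_, ?_⟩
    · intro i
      refine Fin.cases ?_ (fun i => ?_) i
      · simpa using hxy
      · simpa using hd i
    · intro i j
      refine Fin.cases ?_ (fun i => ?_) i <;> refine Fin.cases ?_ (fun j => ?_) j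
      · simp
      · exact fun _ => (hs' j (x, y) (Finset.mem_insert_self _ _)).2
      · exact fun _ => (hs' i (x, y) (Finset.mem_insert_self _ _)).1
      · exact fun hij => ho i j fun h => hij (by rw [h])
    · intro i q hq
      refine Fin.cases ?_ (fun i => ?_) i
      · exact ⟨hxs q hq, hys q hq⟩
      · exact hs' i q (Finset.mem_insert_of_mem hq)

end LargeTensor

section LargeFirstDimension

variable {ι1 ι2 : Type*} {c : ℕ}

theorem exists_linearIndependent_entries {T : ι1 → ι2 → Fin c → F}
    (h3 : LinearIndependent F fun k i j => T i j k) :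
    ∃ p : Fin c → ι1 × ι2, LinearIndependent F fun a => T (p a).1 (p a).2 := by
  obtain ⟨κ, a, _, hspan, hli⟩ := exists_linearIndependent' F fun p : ι1 × ι2 => T p.1 p.2
  rw [span_range_eq_top h3] at hspan
  let b := Module.Basis.mk hli hspan.ge
  have : Finite κ := Module.Finite.finite_basis b
  have := Fintype.ofFinite κ
  have hcard : Fintype.card κ = c := by
    rw [← Module.finrank_eq_card_basis b, Module.finrank_fin_fun]
  let e := (Fintype.equivFinOfCardEq hcard).symm
  exact ⟨a ∘ e, hli.comp e e.injective⟩

theorem exists_sum_mul_ne_zero {v d : Fin c → Fin c → F} (hv : LinearIndependent F v)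
    (hd : ∀ a b, ∑ k, d a k * v b k = if a = b then 1 else 0) {w : Fin c → F} (hw : w ≠ 0) :
    ∃ a, ∑ k, d a k * w k ≠ 0 := by
  by_contra! h
  have hw' : w ∈ Submodule.span F (Set.range v) := by
    rw [hv.span_eq_top_of_card_eq_finrank' (by simp)]
    trivial
  obtain ⟨g, rfl⟩ := (Submodule.mem_span_range_iff_exists_fun F).mp hw'
  refine hw (Finset.sum_eq_zero fun a _ => ?_)
  have ha := h a
  simp only [Finset.sum_apply, Pi.smul_apply, smul_eq_mul, Finset.mul_sum] at ha
  rw [Finset.sum_comm] at ha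
  have hga : g a = 0 := by
    rw [← ha]
    simp only [mul_left_comm _ (g _), ← Finset.mul_sum, hd]
    simp
  rw [hga, zero_smul]

variable [Fintype ι1] [Fintype ι2]

theorem pow_le_subrank_kronPow_mul_of_lt_card {T : ι1 → ι2 → Fin c → F}
    (h1 : LinearIndependent F T) (h3 : LinearIndependent F fun k i j => T i j k) (hc : 0 < c)
    (hcard : (c + c * c ^ c) * c + (c + c * c ^ c) * c * c < Fintype.card ι1) (l : ℕ) :
    c ^ (c * l) ≤ subrank (kronPow T (c * l)) * c := by
  classical
  obtain ⟨p, hp⟩ := exists_linearIndependent_entries h3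
  obtain ⟨d, hd⟩ := exists_dual_family _ hp
  let ξ : Fin c → ι1 → F := fun a => Pi.single (p a).1 1
  let η : Fin c → ι2 → F := fun a => Pi.single (p a).2 1
  have hξη : ∀ a, bil T (ξ a) (η a) = T (p a).1 (p a).2 := fun a => bil_single T _ _
  have hinj : Function.Injective (bil T) := by
    refine (injective_iff_map_eq_zero _).mpr fun x hx => ?_
    rw [Fintype.linearIndependent_iff] at h1
    refine funext (h1 x ?_)
    ext j k
    have := congrFun (LinearMap.congr_fun hx (Pi.single j 1)) k
    simpa [bil_apply, Pi.single_apply] using this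
  obtain ⟨x, y, hd0, hoff, hs⟩ := exists_biorthogonal (bil T) hinj (c + c * c ^ c)
    (by simpa using hcard) (c * c ^ c) (Finset.univ.image fun a => (ξ a, η a))
    (by
      have := Finset.card_image_le (s := (Finset.univ : Finset (Fin c)))
        (f := fun a => (ξ a, η a))
      simp only [Finset.card_univ, Fintype.card_fin] at this
      omega)
  have hs1 : ∀ i a, bil T (x i) (η a) = 0 := fun i a =>
    (hs i (ξ a, η a) (Finset.mem_image_of_mem _ (Finset.mem_univ a))).1
  have hs2 : ∀ i a, bil T (ξ a) (y i) = 0 := fun i a =>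
    (hs i (ξ a, η a) (Finset.mem_image_of_mem _ (Finset.mem_univ a))).2
  have hlead : ∀ i, ∃ k, ∑ t, d k t * bil T (x i) (y i) t ≠ 0 ∧
      ∀ a < k, ∑ t, d a t * bil T (x i) (y i) t = 0 := by
    intro i
    obtain ⟨k, hk, hmin⟩ := exists_minimal_of_wellFoundedLT
      (fun a => ∑ t, d a t * bil T (x i) (y i) t ≠ 0) (exists_sum_mul_ne_zero hp hd (hd0 i))
    refine ⟨k, hk, fun a ha => ?_⟩
    by_contra hne
    exact ha.not_ge (hmin hne ha.le)
  choose κ hκ hκ' using hlead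
  have : Nonempty (Fin c) := ⟨⟨0, hc⟩⟩
  obtain ⟨k, hk⟩ := Fintype.exists_le_card_fiber_of_mul_le_card (n := c ^ c) κ (by simp)
  obtain ⟨s, hsub, hscard⟩ := Finset.exists_subset_card_eq hk
  let e := s.orderEmbOfFin hscard
  have he : ∀ i, κ (e i) = k := fun i => by
    simpa using hsub (s.orderEmbOfFin_mem hscard i)
  let T' : Fin c ⊕ Fin (c ^ c) → Fin c ⊕ Fin (c ^ c) → Fin c → F := fun u v a =>
    ∑ t, d a t * bil T (Sum.elim ξ (x ∘ e) u) (Sum.elim η (y ∘ e) v) t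
  have hres : Restricts T T' := (restricts_iff_bil _ _).mpr ⟨_, _, _, fun _ _ _ => rfl⟩
  refine (pow_le_subrank_kronPow_mul le_rfl k T' ?_ ?_ ?_ ?_ ?_ ?_ l).trans
    (Nat.mul_le_mul_right c (hres.kronPow _).subrank_le)
  · intro a
    ext b
    simp only [T', Sum.elim_inl, hξη, hd, Pi.single_apply]
  · intro a i
    ext b
    simp [T', hs2]
  · intro a i
    ext b
    simp [T', hs1]
  · intro i j hij
    ext b
    simp [T', hoff _ _ fun h => hij (e.injective h)]
  · intro i
    have := hκ (e i)
    rw [he i] at this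
    exact this
  · intro i
    have := hκ' (e i)
    rw [he i] at this
    exact this

theorem asympSubrank_eq_of_lt_card {T : ι1 → ι2 → Fin c → F}
    (h1 : LinearIndependent F T) (h3 : LinearIndependent F fun k i j => T i j k)
    (hcard : (c + c * c ^ c) * c + (c + c * c ^ c) * c * c < Fintype.card ι1) :
    asympSubrank T = c := by
  refine le_antisymm (by simpa using asympSubrank_le_card T) ?_
  rcases Nat.eq_zero_or_pos c with hc | hc
  · simpa [hc] using asympSubrank_nonneg T
  by_contra! hlt
  have hc' : (0 : ℝ) < c := Nat.cast_pos.mpr hc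
  have hA := asympSubrank_nonneg T
  obtain ⟨n, hn⟩ := exists_pow_lt_of_lt_one (inv_pos.mpr hc')
    ((div_lt_one hc').mpr hlt)
  obtain ⟨m, hm⟩ : ∃ m, c * (n + 1) = m + 1 :=
    ⟨c * (n + 1) - 1, by have : 0 < c * (n + 1) := Nat.mul_pos hc n.succ_pos; omega⟩
  have hnm : n ≤ m + 1 := by
    have := Nat.mul_le_mul_right (n + 1) hc
    omega
  have hpow : (c : ℝ) ^ (m + 1) ≤ asympSubrank T ^ (m + 1) * c := by
    have h := pow_le_subrank_kronPow_mul_of_lt_card h1 h3 hc hcard (n + 1)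
    rw [hm] at h
    calc (c : ℝ) ^ (m + 1) ≤ subrank (kronPow T (m + 1)) * c := by exact_mod_cast h
      _ ≤ _ := mul_le_mul_of_nonneg_right (subrank_kronPow_le_asympSubrank_pow T m) hc'.le
  have hpow' : (asympSubrank T / c) ^ (m + 1) < (c : ℝ)⁻¹ :=
    (pow_le_pow_of_le_one (div_nonneg hA hc'.le) ((div_lt_one hc').mpr hlt).le hnm).trans_lt hn
  rw [div_pow, div_lt_iff₀ (pow_pos hc' _), inv_mul_eq_div, lt_div_iff₀ hc'] at hpow'
  exact absurd hpow' hpow.not_gt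

end LargeFirstDimension

section Finiteness

theorem restricts_of_forall_eq_sum {ι1 κ1 ι2 ι3 : Type*} [Fintype ι1] [Fintype ι2] [Fintype ι3]
    {T : ι1 → ι2 → ι3 → F} {S : κ1 → ι2 → ι3 → F} (h : ∀ a, ∃ g : ι1 → F, ∑ i, g i • T i = S a) :
    Restricts T S := by
  classical
  choose g hg using h
  refine ⟨g, fun b => Pi.single b 1, fun c => Pi.single c 1, fun a b c => ?_⟩
  rw [← hg]
  simp [Pi.single_apply]

theorem exists_subtensor_of_not_linearIndependent {n : ℕ} {ι2 ι3 : Type*} [Fintype ι2]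
    [Fintype ι3] {T : Fin n → ι2 → ι3 → F} (h : ¬ LinearIndependent F T) :
    ∃ k < n, ∃ a : Fin k → Fin n, asympSubrank (fun i => T (a i)) = asympSubrank T := by
  classical
  obtain ⟨κ, a, ha, hspan, hli⟩ := exists_linearIndependent' F T
  have : Finite κ := Finite.of_injective a ha
  have := Fintype.ofFinite κ
  let e := (Fintype.equivFin κ).symm
  have hae : Function.Injective (a ∘ e) := ha.comp e.injective
  refine ⟨Fintype.card κ, lt_of_le_of_ne ?_ fun hcard => h ?_, a ∘ e, le_antisymm ?_ ?_⟩
  · simpa using Fintype.card_le_of_injective a ha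
  · have hbij : Function.Bijective a :=
      (Fintype.bijective_iff_injective_and_card a).mpr ⟨ha, by simpa using hcard⟩
    exact (linearIndependent_equiv (Equiv.ofBijective a hbij)).mp hli
  · exact (restricts_of_forall_eq_sum fun i => ⟨Pi.single (a (e i)) 1, by
      simp [Pi.single_apply, ite_smul]⟩).asympSubrank_le
  · refine (restricts_of_forall_eq_sum fun i => ?_).asympSubrank_le
    have hi : T i ∈ Submodule.span F (Set.range fun i => T (a (e i))) := by
      have : Set.range (fun i => T (a (e i))) = Set.range (T ∘ a) :=
        e.surjective.range_comp (T ∘ a)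
      rw [this, hspan]
      exact Submodule.subset_span ⟨i, rfl⟩
    exact (Submodule.mem_span_range_iff_exists_fun F).mp hi

/-- `T` is a tensor with coefficients in `S`, independent slices in each direction, and
asymptotic subrank `y`. -/
structure IsConciseWitness (S : Set F) (y : ℝ) {n1 n2 n3 : ℕ}
    (T : Fin n1 → Fin n2 → Fin n3 → F) : Prop where
  mem : ∀ i j k, T i j k ∈ S
  eq : y = asympSubrank T
  indep1 : LinearIndependent F T
  indep2 : LinearIndependent F fun j i k => T i j k
  indep3 : LinearIndependent F fun k i j => T i j k

theorem exists_isConciseWitness {S : Set F} {y : ℝ} {n1 n2 n3 : ℕ}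
    (T : Fin n1 → Fin n2 → Fin n3 → F) (hT : ∀ i j k, T i j k ∈ S) (hy : y = asympSubrank T) :
    ∃ (m1 m2 m3 : ℕ) (T' : Fin m1 → Fin m2 → Fin m3 → F), IsConciseWitness S y T' := by
  induction hN : n1 + n2 + n3 using Nat.strong_induction_on generalizing n1 n2 n3 with
  | _ N ih =>
    by_cases h1 : LinearIndependent F T
    · by_cases h2 : LinearIndependent F fun j i k => T i j k
      · by_cases h3 : LinearIndependent F fun k i j => T i j k
        · exact ⟨n1, n2, n3, T, hT, hy, h1, h2, h3⟩
        · obtain ⟨k, hk, a, ha⟩ := exists_subtensor_of_not_linearIndependent h3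
          refine ih _ (by omega) (fun i j k => T i j (a k)) (fun i j k => hT _ _ _) ?_ rfl
          rw [hy, ← asympSubrank_swap23 T, ← asympSubrank_swap12, ← ha,
            ← asympSubrank_swap12, ← asympSubrank_swap23]
      · obtain ⟨k, hk, a, ha⟩ := exists_subtensor_of_not_linearIndependent h2
        refine ih _ (by omega) (fun i j k => T i (a j) k) (fun i j k => hT _ _ _) ?_ rfl
        rw [hy, ← asympSubrank_swap12 T, ← ha, ← asympSubrank_swap12]
    · obtain ⟨k, hk, a, ha⟩ := exists_subtensor_of_not_linearIndependent h1
      exact ih _ (by omega) (fun i => T (a i)) (fun i j k => hT _ _ _) (hy.trans ha.symm) rfl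

theorem linearIndependent_swap {ι1 ι2 ι3 : Type*} [Fintype ι1] {T : ι1 → ι2 → ι3 → F}
    (h : LinearIndependent F T) : LinearIndependent F fun i k j => T i j k := by
  rw [Fintype.linearIndependent_iff] at h ⊢
  intro g hg
  refine h g ?_
  ext j k
  simpa using congrFun (congrFun hg k) j

theorem IsConciseWitness.swap12 {S : Set F} {y : ℝ} {n1 n2 n3 : ℕ}
    {T : Fin n1 → Fin n2 → Fin n3 → F} (h : IsConciseWitness S y T) :
    IsConciseWitness S y fun j i k => T i j k :=
  ⟨fun _ _ _ => h.mem _ _ _, by rw [asympSubrank_swap12, h.eq], h.indep2, h.indep1,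
    linearIndependent_swap h.indep3⟩

theorem IsConciseWitness.swap23 {S : Set F} {y : ℝ} {n1 n2 n3 : ℕ}
    {T : Fin n1 → Fin n2 → Fin n3 → F} (h : IsConciseWitness S y T) :
    IsConciseWitness S y fun i k j => T i j k :=
  ⟨fun _ _ _ => h.mem _ _ _, by rw [asympSubrank_swap23, h.eq], linearIndependent_swap h.indep1,
    h.indep3, h.indep2⟩

theorem IsConciseWitness.exists_dim_le {S : Set F} {y : ℝ} {n1 n2 n3 : ℕ}
    {T : Fin n1 → Fin n2 → Fin n3 → F} (h : IsConciseWitness S y T) {r : ℕ}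
    (hr : y ^ 2 < (r + 1 : ℕ)) :
    ∃ (m1 m2 m3 : ℕ) (T' : Fin m1 → Fin m2 → Fin m3 → F),
      IsConciseWitness S y T' ∧ m3 ≤ r ^ 2 * r := by
  by_cases h3 : n3 ≤ r ^ 2 * r
  · exact ⟨_, _, _, _, h, h3⟩
  by_cases h2 : n2 ≤ r ^ 2 * r
  · exact ⟨_, _, _, _, h.swap23, h2⟩
  by_cases h1 : n1 ≤ r ^ 2 * r
  · exact ⟨_, _, _, _, h.swap12.swap23, h1⟩
  have := le_asympSubrank_sq (r := r) h.indep1 h.indep2 h.indep3 (by simpa using h1)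
    (by simpa using h2) (by simpa using h3)
  rw [← h.eq] at this
  exact absurd hr this.not_gt

theorem IsConciseWitness.dim2_le {S : Set F} {y : ℝ} {n1 n2 n3 : ℕ}
    {T : Fin n1 → Fin n2 → Fin n3 → F} (h : IsConciseWitness S y T) : n2 ≤ n1 * n3 := by
  simpa [Module.finrank_pi_fintype] using h.indep2.fintype_card_le_finrank

theorem finite_asympSubrank_values {S : Set F} (hS : S.Finite) (B : ℝ) :
    {y : ℝ | (∃ (n1 n2 n3 : ℕ) (T : Fin n1 → Fin n2 → Fin n3 → F),
      (∀ i j k, T i j k ∈ S) ∧ y = asympSubrank T) ∧ y ≤ B}.Finite := by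
  obtain ⟨r, hr⟩ := exists_nat_gt (B ^ 2)
  let N : ℕ → ℕ := fun c => (c + c * c ^ c) * c + (c + c * c ^ c) * c * c
  let D := r ^ 2 * r
  have hfin : ∀ n1 n2 n3 : ℕ,
      {T : Fin n1 → Fin n2 → Fin n3 → F | ∀ i j k, T i j k ∈ S}.Finite := fun n1 n2 n3 =>
    Set.Finite.pi' fun _ => Set.Finite.pi' fun _ => Set.Finite.pi' fun _ => hS
  have hbig : (((fun n : ℕ => (n : ℝ)) '' Set.Iic D) ∪
      ⋃ n3 ∈ Set.Iic D, ⋃ n1 ∈ Set.Iic (N n3), ⋃ n2 ∈ Set.Iic (n1 * n3),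
        asympSubrank '' {T : Fin n1 → Fin n2 → Fin n3 → F | ∀ i j k, T i j k ∈ S}).Finite :=
    ((Set.finite_Iic D).image _).union <|
      (Set.finite_Iic D).biUnion fun n3 _ => (Set.finite_Iic _).biUnion fun n1 _ =>
        (Set.finite_Iic _).biUnion fun n2 _ => (hfin n1 n2 n3).image _
  refine hbig.subset ?_
  rintro y ⟨⟨k1, k2, k3, T₀, hT₀, hy⟩, hyB⟩
  obtain ⟨l1, l2, l3, T₁, hT₁⟩ := exists_isConciseWitness T₀ hT₀ hy
  have hy0 : 0 ≤ y := hy ▸ asympSubrank_nonneg T₀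
  obtain ⟨n1, n2, n3, T, hT, hn3⟩ := hT₁.exists_dim_le (r := r) (by
    push_cast
    nlinarith)
  by_cases hn1 : n1 ≤ N n3
  · refine Or.inr ?_
    simp only [Set.mem_iUnion]
    exact ⟨n3, hn3, n1, hn1, n2, hT.dim2_le, T, hT.mem, hT.eq.symm⟩
  · refine Or.inl ⟨n3, hn3, ?_⟩
    rw [hT.eq]
    exact (asympSubrank_eq_of_lt_card hT.indep1 hT.indep3 (by simpa using not_le.mp hn1)).symm

end Finiteness

/-- Over any field `F` and any finite coefficient set `S ⊆ F`, the set
of values of the asymptotic subrank on order-three tensors with coefficients in `S`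
has no accumulation points. -/
theorem asympSubrank_values_no_accumulation (F : Type*) [Field F]
    (S : Set F) (hS : S.Finite) :
    ∀ x : ℝ, ¬ AccPt x (Filter.principal
      {y : ℝ | ∃ (n1 n2 n3 : ℕ) (T : Fin n1 → Fin n2 → Fin n3 → F),
        (∀ i j k, T i j k ∈ S) ∧ y = asympSubrank T}) := by
  intro x hx
  have h := AccPt.nhds_inter hx (Iic_mem_nhds (lt_add_one x))
  exact Set.Infinite.of_accPt h ((finite_asympSubrank_values hS (x + 1)).subset
    fun y hy => ⟨hy.2, hy.1⟩)

end Paper
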